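/- Let A be a commutative von Neumann regular ring that is real closed *. Then for every prime ideal p of A, the residue field A/p is a real closed field. -/

import Mathlib

universe u

/-- A commutative ring is formally real if a finite sum of squares can only vanish
when all the summands vanish. -/
def IsFormallyRealRing (R : Type*) [CommRing R] : Prop :=
  ∀ (n : ℕ) (f : Fin n → R), (∑ i, f i ^ 2) = 0 → ∀ i, f i = 0

/-- A subring `A` of `R` is essential in `R` if every nonzero ideal of `R` meets `A`
in a nonzero element. -/
def Subring.IsEssentialIn {R : Type*} [CommRing R] (A : Subring R) : Prop :=
  ∀ I : Ideal R, I ≠ ⊥ → ∃ x ∈ I, x ∈ A ∧ x ≠ 0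

/-- A commutative ring `A` is real closed * if it is formally real and it admits no
proper formally real extension ring that is both integral over `A` and an essential
extension of `A`: every embedding of `A` into a formally real ring `B` which is
integral over (the image of) `A` and essential over it is surjective. -/
def IsRealClosedStar (A : Type u) [CommRing A] : Prop :=
  IsFormallyRealRing A ∧
    ∀ (B : Type u) [CommRing B] (f : A →+* B), Function.Injective f →
      IsFormallyRealRing B →
      (∀ b : B, ∃ p : Polynomial B, p.Monic ∧ (∀ n, p.coeff n ∈ f.range) ∧
        Polynomial.eval b p = 0) →
      (f.range : Subring B).IsEssentialIn →
      Function.Surjective f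

/-- A commutative ring is a real closed field if it is a field, it is formally real
(`-1` is not a sum of squares), every element or its negative is a square, and every
polynomial of odd degree has a root. -/
def IsRealClosedField (F : Type*) [CommRing F] : Prop :=
  IsField F ∧
  (¬ ∃ (n : ℕ) (f : Fin n → F), (∑ i, f i ^ 2) = -1) ∧
  (∀ x : F, (∃ y : F, y ^ 2 = x) ∨ (∃ y : F, y ^ 2 = -x)) ∧
  (∀ p : Polynomial F, Odd p.natDegree → ∃ x : F, Polynomial.eval x p = 0)

open Polynomial

/-- A sum of squares is the sum of the squares of a finite family. -/
theorem IsSumSq.exists_fin_sum_sq {R : Type*} [CommRing R] {s : R} (hs : IsSumSq s) :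
    ∃ (n : ℕ) (f : Fin n → R), ∑ i, f i ^ 2 = s := by
  induction hs with
  | zero => exact ⟨0, Fin.elim0, by simp⟩
  | sq_add a _ ih =>
    obtain ⟨n, f, rfl⟩ := ih
    exact ⟨n + 1, Fin.cons a f, by simp [Fin.sum_univ_succ, sq]⟩

theorem IsSumSq.map_ringHom {R S : Type*} [CommRing R] [CommRing S] (φ : R →+* S) {s : R}
    (hs : IsSumSq s) : IsSumSq (φ s) := by
  induction hs with
  | zero => simp
  | sq_add a _ ih =>
    rw [map_add, map_mul]
    exact .sq_add _ ih

theorem IsSumSq.div_field {K : Type*} [Field K] {s t : K} (hs : IsSumSq s) (ht : IsSumSq t) :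
    IsSumSq (s / t) := by
  have h : s / t = s * t * (t⁻¹ * t⁻¹) := by
    rcases eq_or_ne t 0 with rfl | h0
    · simp
    · field_simp
  rw [h]
  exact (hs.mul ht).mul (.mul_self _)

/-- A nontrivial formally real ring is semireal. -/
theorem IsFormallyRealRing.not_isSumSq_neg_one {R : Type*} [CommRing R] [Nontrivial R]
    (hR : IsFormallyRealRing R) : ¬ IsSumSq (-1 : R) := by
  intro h
  obtain ⟨n, f, hf⟩ := h.exists_fin_sum_sq
  simpa using hR (n + 1) (Fin.cons 1 f) (by simp [Fin.sum_univ_succ, hf]) 0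

theorem isFormallyRealRing_of_not_isSumSq_neg_one {K : Type*} [Field K]
    (hK : ¬ IsSumSq (-1 : K)) : IsFormallyRealRing K := by
  intro n f hf i
  by_contra hi
  apply hK
  have h : (-1 : K) = (∑ j ∈ Finset.univ.erase i, f j ^ 2) / (f i ^ 2) := by
    rw [eq_div_iff (pow_ne_zero 2 hi)]
    rw [← Finset.add_sum_erase _ _ (Finset.mem_univ i)] at hf
    linear_combination -hf
  rw [h]
  exact (IsSumSq.sum_sq _ _).div_field (by rw [sq]; exact .mul_self _)

theorem IsFormallyRealRing.pi {ι : Type*} {R : ι → Type*} [∀ i, CommRing (R i)]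
    (hR : ∀ i, IsFormallyRealRing (R i)) : IsFormallyRealRing (∀ i, R i) := by
  intro n f hf i
  funext j
  exact hR j n (fun k ↦ f k j) (by simpa using congrFun hf j) i

theorem IsFormallyRealRing.of_injective {R S : Type*} [CommRing R] [CommRing S] (φ : R →+* S)
    (hφ : Function.Injective φ) (hS : IsFormallyRealRing S) : IsFormallyRealRing R := by
  intro n f hf i
  apply hφ
  rw [map_zero]
  exact hS n (fun k ↦ φ (f k)) (by simpa using congrArg φ hf) i

theorem IsFormallyRealRing.isReduced {R : Type*} [CommRing R] (hR : IsFormallyRealRing R) :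
    IsReduced R := by
  rw [isReduced_iff_pow_one_lt 2 (by norm_num)]
  intro x hx
  exact hR 1 (fun _ ↦ x) (by simpa using hx) 0

/-- Quotients of formally real von Neumann regular rings are formally real. -/
theorem IsFormallyRealRing.quotient {R : Type*} [CommRing R]
    (hvnr : ∀ a : R, ∃ b : R, a = a * b * a) (hR : IsFormallyRealRing R) (I : Ideal R) :
    IsFormallyRealRing (R ⧸ I) := by
  intro n f hf i
  choose g hg using fun k ↦ Ideal.Quotient.mk_surjective (f k)
  have hs : ∑ k, g k ^ 2 ∈ I := by
    rw [← Ideal.Quotient.eq_zero_iff_mem]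
    simpa [hg] using hf
  obtain ⟨b, hb⟩ := hvnr (∑ k, g k ^ 2)
  set s := ∑ k, g k ^ 2 with hsdef
  have h0 : (1 - s * b) * g i = 0 := by
    refine hR n (fun k ↦ (1 - s * b) * g k) ?_ i
    simp only [mul_pow, ← Finset.mul_sum, ← hsdef]
    linear_combination (1 - s * b) * hb
  have h1 : g i = s * (b * g i) := by linear_combination h0
  rw [← hg i, Ideal.Quotient.eq_zero_iff_mem, h1]
  exact I.mul_mem_right _ hs

/-- Prime ideals of a von Neumann regular ring are maximal. -/
theorem krullDimLE_zero_of_vonNeumannRegular {R : Type*} [CommRing R]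
    (hvnr : ∀ a : R, ∃ b : R, a = a * b * a) : Ring.KrullDimLE 0 R := by
  refine .mk₀ fun p hp ↦ Ideal.Quotient.maximal_of_isField p ?_
  refine ⟨⟨0, 1, zero_ne_one⟩, mul_comm, fun {a} ha ↦ ?_⟩
  obtain ⟨a, rfl⟩ := Ideal.Quotient.mk_surjective a
  obtain ⟨b, hb⟩ := hvnr a
  refine ⟨Ideal.Quotient.mk p b, mul_right_cancel₀ ha ?_⟩
  rw [one_mul, ← map_mul, ← map_mul, ← hb]

/-- A reduced zero-dimensional ring is von Neumann regular. -/
theorem vonNeumannRegular_of_krullDimLE_zero {R : Type*} [CommRing R] [IsReduced R]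
    [Ring.KrullDimLE 0 R] (a : R) : ∃ b : R, a = a * b * a := by
  let M : Submonoid R :=
    { carrier := {x | ∃ (n : ℕ) (c : R), x = a ^ n * (1 - a * c)}
      one_mem' := ⟨0, 0, by simp⟩
      mul_mem' := by
        rintro _ _ ⟨m, c, rfl⟩ ⟨n, d, rfl⟩
        exact ⟨m + n, c + d - a * c * d, by ring⟩ }
  by_cases h0 : (0 : R) ∈ M
  · obtain ⟨n, c, hc⟩ := h0
    have hnil : IsNilpotent (a * (1 - a * c)) := by
      refine ⟨n + 1, ?_⟩
      rw [mul_pow, pow_succ, pow_succ]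
      linear_combination (- a * (1 - a * c) ^ n) * hc
    exact ⟨c, by linear_combination hnil.eq_zero⟩
  · obtain ⟨p, hp, -, hdisj⟩ := Ideal.exists_le_prime_disjoint (⊥ : Ideal R) M <| by
      rw [Set.disjoint_left]
      rintro x hx hxM
      rw [SetLike.mem_coe, Ideal.mem_bot] at hx
      exact h0 (hx ▸ hxM)
    rw [Set.disjoint_left] at hdisj
    have ha : a ∉ p := fun ha ↦ hdisj ha ⟨1, 0, by simp⟩
    obtain ⟨c, i, hi, h⟩ := hp.isMaximal'.exists_inv ha
    exact absurd (⟨0, c, by linear_combination h⟩ : i ∈ M) (hdisj hi)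

/-- An integral extension of a zero-dimensional ring is zero-dimensional. -/
theorem Algebra.IsIntegral.krullDimLE_zero (R S : Type*) [CommRing R] [CommRing S] [Algebra R S]
    [Algebra.IsIntegral R S] [Ring.KrullDimLE 0 R] : Ring.KrullDimLE 0 S :=
  .mk₀ fun q _ ↦ Ideal.isMaximal_of_isIntegral_of_isMaximal_comap (R := R) q inferInstance

/-- Every ring extension has a quotient that is an essential extension. -/
theorem exists_ideal_comap_eq_bot_essential {R S : Type*} [CommRing R] [CommRing S] (φ : R →+* S)
    (hφ : Function.Injective φ) :
    ∃ I : Ideal S, I.comap φ = ⊥ ∧ ∀ J : Ideal S, I < J → J.comap φ ≠ ⊥ := by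
  have hchain : ∀ c ⊆ {I : Ideal S | I.comap φ = ⊥}, IsChain (· ≤ ·) c → ∀ J ∈ c,
      ∃ K ∈ {I : Ideal S | I.comap φ = ⊥}, ∀ I ∈ c, I ≤ K := by
    intro c hc hchain J hJ
    refine ⟨sSup c, ?_, fun K hK ↦ le_sSup hK⟩
    rw [Set.mem_ofPred_eq, eq_bot_iff]
    intro x hx
    rw [Ideal.mem_comap, Submodule.mem_sSup_of_directed ⟨J, hJ⟩ hchain.directedOn] at hx
    obtain ⟨K, hK, hxK⟩ := hx
    have : x ∈ Ideal.comap φ K := hxK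
    rwa [show Ideal.comap φ K = ⊥ from hc hK] at this
  obtain ⟨I, -, hI⟩ :=
    zorn_le_nonempty₀ _ hchain ⊥ ((RingHom.injective_iff_ker_eq_bot φ).mp hφ)
  exact ⟨I, hI.prop, fun J hJ h ↦ hI.not_prop_of_gt hJ h⟩

/-- A real closed * von Neumann regular ring is a retract of each formally real integral
extension. -/
theorem IsRealClosedStar.exists_retraction {A : Type u} [CommRing A]
    (hvnr : ∀ a : A, ∃ b : A, a = a * b * a) (hA : IsRealClosedStar A)
    (B : Type u) [CommRing B] [Algebra A B] [Algebra.IsIntegral A B]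
    (hinj : Function.Injective (algebraMap A B)) (hB : IsFormallyRealRing B) :
    ∃ r : B →+* A, r.comp (algebraMap A B) = RingHom.id A := by
  obtain ⟨I, hI, hmax⟩ := exists_ideal_comap_eq_bot_essential (algebraMap A B) hinj
  have := krullDimLE_zero_of_vonNeumannRegular hvnr
  have := hB.isReduced
  have := Algebra.IsIntegral.krullDimLE_zero A B
  let φ : A →+* B ⧸ I := (Ideal.Quotient.mk I).comp (algebraMap A B)
  have hφ : Function.Injective φ := by
    rw [RingHom.injective_iff_ker_eq_bot, ← hI]
    ext x
    exact Ideal.Quotient.eq_zero_iff_mem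
  have hsurj : Function.Surjective φ := by
    refine hA.2 (B ⧸ I) φ hφ (hB.quotient vonNeumannRegular_of_krullDimLE_zero I) ?_ ?_
    · intro b
      obtain ⟨b, rfl⟩ := Ideal.Quotient.mk_surjective b
      obtain ⟨P, hP, hb⟩ := Algebra.IsIntegral.isIntegral (R := A) b
      refine ⟨P.map φ, hP.map φ, fun n ↦ ⟨P.coeff n, by simp⟩, ?_⟩
      rw [eval_map, ← hom_eval₂, hb, map_zero]
    · intro J hJ
      have hlt : I < J.comap (Ideal.Quotient.mk I) := by
        refine lt_of_le_of_ne (fun x hx ↦ ?_) fun h ↦ hJ ?_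
        · rw [Ideal.mem_comap, Ideal.Quotient.eq_zero_iff_mem.mpr hx]
          exact J.zero_mem
        · rw [← Ideal.map_comap_of_surjective _ Ideal.Quotient.mk_surjective J, ← h,
            Ideal.map_quotient_self]
      obtain ⟨x, hx, hx0⟩ := Submodule.exists_mem_ne_zero_of_ne_bot (hmax _ hlt)
      exact ⟨φ x, hx, ⟨x, rfl⟩, (map_ne_zero_iff φ hφ).mpr hx0⟩
  let e := RingEquiv.ofBijective φ ⟨hφ, hsurj⟩
  refine ⟨(e.symm : B ⧸ I →+* A).comp (Ideal.Quotient.mk I), ?_⟩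
  ext x
  exact e.symm_apply_apply x

/-- A monic polynomial over a real closed * von Neumann regular ring has a root as soon as it
acquires one in some formally real extension of each residue field. -/
theorem IsRealClosedStar.exists_root {A : Type u} [CommRing A]
    (hvnr : ∀ a : A, ∃ b : A, a = a * b * a) (hA : IsRealClosedStar A) (P : A[X]) (hP : P.Monic)
    (hloc : ∀ q : PrimeSpectrum A, ∃ (L : Type u) (_ : Field L) (φ : A →+* L),
      RingHom.ker φ ≤ q.asIdeal ∧ ¬ IsSumSq (-1 : L) ∧ ∃ x, P.eval₂ φ x = 0) :
    ∃ x, P.eval x = 0 := by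
  choose L hL φ hker hreal x hx using hloc
  let Φ : A →+* (∀ q, L q) := RingHom.pi φ
  have hΦ : Function.Injective Φ := by
    have := hA.1.isReduced
    rw [injective_iff_map_eq_zero]
    intro a ha
    refine IsNilpotent.eq_zero ?_
    rw [nilpotent_iff_mem_prime]
    exact fun q hq ↦ hker ⟨q, hq⟩ (congrFun ha ⟨q, hq⟩)
  algebraize [Φ]
  have hroot : P.eval₂ Φ x = 0 :=
    funext fun q ↦ (hom_eval₂ P Φ (Pi.evalRingHom L q) x).trans (hx q)
  let B := integralClosure A (∀ q, L q)
  have hreal' : IsFormallyRealRing B :=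
    (IsFormallyRealRing.pi fun q ↦ isFormallyRealRing_of_not_isSumSq_neg_one (hreal q)).of_injective
      B.val.toRingHom Subtype.val_injective
  have hinj : Function.Injective (algebraMap A B) := fun a b h ↦ hΦ (congrArg Subtype.val h)
  obtain ⟨r, hr⟩ := hA.exists_retraction hvnr B hinj hreal'
  let y : B := ⟨x, P, hP, hroot⟩
  have hy : P.eval₂ (algebraMap A B) y = 0 := by
    apply Subtype.val_injective
    change B.val.toRingHom _ = _
    rw [hom_eval₂]
    exact hroot
  refine ⟨r y, ?_⟩
  have := congrArg r hy
  rwa [hom_eval₂, hr, map_zero] at this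

/-- A semireal field has a semireal extension in which a given element becomes, up to sign,
a square. -/
theorem exists_extension_pow_four_eq_sq {K : Type u} [Field K] (hK : ¬ IsSumSq (-1 : K)) (a : K) :
    ∃ (L : Type u) (_ : Field L) (φ : K →+* L), ¬ IsSumSq (-1 : L) ∧ ∃ x, x ^ 4 = φ (a ^ 2) := by
  wlog ha : ¬ IsSumSq (-a) generalizing a
  · rcases eq_or_ne a 0 with rfl | h0
    · exact ⟨K, _, RingHom.id K, hK, 0, by simp⟩
    · have h1 : ¬ IsSumSq (- -a) := by
        intro h
        rw [not_not] at ha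
        apply hK
        have := ha.div_field h
        rwa [neg_neg, neg_div, div_self h0] at this
      simpa using this (-a) h1
  by_cases hsq : ∃ y, y ^ 2 = a
  · obtain ⟨y, rfl⟩ := hsq
    exact ⟨K, _, RingHom.id K, hK, y, by simp; ring⟩
  have hmonic : (X ^ 2 - C a).Monic := monic_X_pow_sub_C a two_ne_zero
  have hirr : Irreducible (X ^ 2 - C a) := by
    rw [hmonic.irreducible_iff_roots_eq_zero_of_degree_le_three (by simp) (by simp)]
    refine Multiset.eq_zero_of_forall_notMem fun y hy ↦ hsq ⟨y, ?_⟩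
    have := isRoot_of_mem_roots hy
    simpa [sub_eq_zero] using this
  have := Fact.mk hirr
  let L := AdjoinRoot (X ^ 2 - C a)
  let φ : K →+* L := AdjoinRoot.of _
  let r : L := AdjoinRoot.root _
  have hr : r ^ 2 = φ a := by
    have := AdjoinRoot.eval₂_root (X ^ 2 - C a)
    simpa [sub_eq_zero] using this
  have hrep (z : L) : ∃ u v, z = φ u + φ v * r := by
    obtain ⟨p, rfl⟩ := AdjoinRoot.mk_surjective z
    induction p using Polynomial.induction_on' with
    | add p q hp hq =>
      obtain ⟨u, v, h⟩ := hp
      obtain ⟨u', v', h'⟩ := hq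
      exact ⟨u + u', v + v', by rw [map_add, h, h', map_add, map_add]; ring⟩
    | monomial n c =>
      induction n with
      | zero => exact ⟨c, 0, by simp [φ]⟩
      | succ n ih =>
        obtain ⟨u, v, h⟩ := ih
        refine ⟨v * a, u, ?_⟩
        rw [← monomial_mul_X, map_mul, h, AdjoinRoot.mk_X, map_mul, ← hr]
        change _ * r = _
        ring
  have hsum {s : L} (hs : IsSumSq s) :
      ∃ p q w, IsSumSq p ∧ IsSumSq q ∧ s = φ (p + a * q) + φ w * r := by
    induction hs with
    | zero => exact ⟨0, 0, 0, .zero, .zero, by simp⟩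
    | sq_add z _ ih =>
      obtain ⟨p, q, w, hp, hq, rfl⟩ := ih
      obtain ⟨u, v, rfl⟩ := hrep z
      refine ⟨u * u + p, v * v + q, 2 * u * v + w, .sq_add u hp, .sq_add v hq, ?_⟩
      simp only [map_add, map_mul, map_ofNat]
      linear_combination (φ v) ^ 2 * hr
  refine ⟨L, inferInstance, φ, fun h ↦ ?_, r, by rw [map_pow, ← hr]; ring⟩
  obtain ⟨p, q, w, hp, hq, h⟩ := hsum h
  have hw : w = 0 := by
    by_contra hw
    refine hsq ⟨(-1 - (p + a * q)) / w, φ.injective ?_⟩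
    have hw' : φ w ≠ 0 := (map_ne_zero φ).mpr hw
    have : φ ((-1 - (p + a * q)) / w) = r := by
      rw [map_div₀, div_eq_iff hw', map_sub, map_neg, map_one]
      linear_combination h
    rw [map_pow, this, hr]
  have h' : -1 = p + a * q := by
    apply φ.injective
    simpa [hw] using h
  rcases eq_or_ne q 0 with rfl | hq0
  · exact hK (by simpa [h'] using hp)
  · apply ha
    have : -a = (1 + p) / q := by
      rw [eq_div_iff hq0]
      linear_combination h'
    rw [this]
    exact (IsSumSq.one.add hp).div_field hq

theorem Polynomial.exists_irreducible_dvd_of_odd_natDegree {K : Type*} [Field K] (P : K[X])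
    (hP : Odd P.natDegree) : ∃ Q, Irreducible Q ∧ Q ∣ P ∧ Odd Q.natDegree := by
  induction P using WfDvdMonoid.induction_on_irreducible with
  | zero => simp at hP
  | unit u hu => simp [natDegree_eq_zero_of_isUnit hu] at hP
  | mul P Q hP0 hQ ih =>
    by_cases hodd : Odd Q.natDegree
    · exact ⟨Q, hQ, dvd_mul_right _ _, hodd⟩
    · rw [natDegree_mul hQ.ne_zero hP0] at hP
      obtain ⟨R, hR, hdvd, hRodd⟩ := ih (by grind)
      exact ⟨R, hR, hdvd.mul_left _, hRodd⟩

/-- Over a semireal field, a nonzero sum of squares of polynomials has even degree. -/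
theorem IsSumSq.even_natDegree {K : Type*} [Field K] (hK : ¬ IsSumSq (-1 : K)) {P : K[X]}
    (hP : IsSumSq P) : Even P.natDegree ∧ IsSumSq P.leadingCoeff := by
  induction hP with
  | zero => simp
  | @sq_add Q S _ ih =>
    obtain ⟨heven, hlead⟩ := ih
    have hdeg : (Q * Q).natDegree = 2 * Q.natDegree := by rw [← sq, natDegree_pow]
    have hdegQ : Even (Q * Q).natDegree := by rw [hdeg]; exact even_two_mul _
    have hleadQ : IsSumSq (Q * Q).leadingCoeff := by rw [leadingCoeff_mul]; exact .mul_self _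
    rcases lt_trichotomy (Q * Q).degree S.degree with h | h | h
    · rw [leadingCoeff_add_of_degree_lt h, natDegree_add_eq_right_of_degree_lt h]
      exact ⟨heven, hlead⟩
    · rcases eq_or_ne S 0 with rfl | hS
      · rw [add_zero]
        exact ⟨hdegQ, hleadQ⟩
      have hsum : (Q * Q).leadingCoeff + S.leadingCoeff ≠ 0 := by
        intro h0
        apply hK
        have : (-1 : K) = (Q * Q).leadingCoeff / S.leadingCoeff := by
          rw [eq_div_iff (leadingCoeff_ne_zero.mpr hS)]
          linear_combination -h0
        rw [this]
        exact hleadQ.div_field hlead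
      rw [leadingCoeff_add_of_degree_eq h hsum,
        natDegree_eq_of_degree_eq (q := S)
          (by rw [degree_add_eq_of_leadingCoeff_add_ne_zero hsum, h, max_self])]
      exact ⟨heven, hleadQ.add hlead⟩
    · rw [leadingCoeff_add_of_degree_lt' h, natDegree_add_eq_left_of_degree_lt h]
      exact ⟨hdegQ, hleadQ⟩

/-- Adjoining a root of an irreducible polynomial of odd degree to a semireal field gives a
semireal field. -/
theorem AdjoinRoot.not_isSumSq_neg_one_of_odd_natDegree {K : Type*} [Field K]
    (hK : ¬ IsSumSq (-1 : K)) (P : K[X]) (hP : Irreducible P) (hodd : Odd P.natDegree) :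
    ¬ IsSumSq (-1 : AdjoinRoot P) := by
  induction hn : P.natDegree using Nat.strong_induction_on generalizing P with
  | _ n ih =>
  subst hn
  intro h
  have hlift {s : AdjoinRoot P} (hs : IsSumSq s) :
      ∃ S : K[X], IsSumSq S ∧ S.natDegree ≤ 2 * (P.natDegree - 1) ∧ AdjoinRoot.mk P S = s := by
    induction hs with
    | zero => exact ⟨0, .zero, by simp, by simp⟩
    | sq_add z _ ih =>
      obtain ⟨S, hS, hdeg, rfl⟩ := ih
      obtain ⟨Q, rfl⟩ := AdjoinRoot.mk_surjective z
      have hQ : AdjoinRoot.mk P (Q % P) = AdjoinRoot.mk P Q := by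
        rw [AdjoinRoot.mk_eq_mk]
        exact ⟨-(Q / P), by linear_combination EuclideanDomain.div_add_mod Q P⟩
      have hlt : (Q % P).natDegree < P.natDegree := natDegree_mod_lt Q hodd.pos.ne'
      refine ⟨Q % P * (Q % P) + S, .sq_add _ hS, natDegree_add_le_of_degree_le ?_ hdeg, ?_⟩
      · rw [← sq, natDegree_pow]
        omega
      · rw [map_add, map_mul, hQ]
  obtain ⟨S, hS, hdeg, hmk⟩ := hlift h
  have hF : IsSumSq (1 + S) := IsSumSq.one.add hS
  have hF0 : 1 + S ≠ 0 := by
    intro h0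
    apply hK
    have := hS.map_ringHom (evalRingHom 0)
    rwa [show S = -1 by linear_combination h0, map_neg, map_one] at this
  obtain ⟨H, hH⟩ : P ∣ 1 + S := by
    rw [← AdjoinRoot.mk_eq_zero, map_add, hmk, map_one, add_neg_cancel]
  have hH0 : H ≠ 0 := by
    rintro rfl
    exact hF0 (by simpa using hH)
  have heven := (hF.even_natDegree hK).1
  have hFdeg : (1 + S).natDegree ≤ 2 * (P.natDegree - 1) :=
    natDegree_add_le_of_degree_le (by simp) hdeg
  rw [hH, natDegree_mul hP.ne_zero hH0] at heven hFdeg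
  have hHodd : Odd H.natDegree := by grind
  obtain ⟨Q, hQ, hQH, hQodd⟩ := H.exists_irreducible_dvd_of_odd_natDegree hHodd
  have hQlt : Q.natDegree < P.natDegree := by
    have := natDegree_le_of_dvd hQH hH0
    have := hodd.pos
    omega
  refine ih _ hQlt Q hQ hQodd rfl ?_
  have hz : AdjoinRoot.mk Q (1 + S) = 0 := by
    rw [AdjoinRoot.mk_eq_zero, hH]
    exact hQH.mul_left P
  rw [map_add, map_one] at hz
  rw [show (-1 : AdjoinRoot Q) = AdjoinRoot.mk Q S by linear_combination -hz]
  exact hS.map_ringHom _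

/-- A polynomial of odd degree over a semireal field has a root in a semireal extension. -/
theorem exists_extension_root_of_odd_natDegree {K : Type u} [Field K] (hK : ¬ IsSumSq (-1 : K))
    (P : K[X]) (hP : Odd P.natDegree) :
    ∃ (L : Type u) (_ : Field L) (φ : K →+* L), ¬ IsSumSq (-1 : L) ∧ ∃ x, P.eval₂ φ x = 0 := by
  obtain ⟨Q, hQ, hdvd, hodd⟩ := P.exists_irreducible_dvd_of_odd_natDegree hP
  have := Fact.mk hQ
  exact ⟨AdjoinRoot Q, inferInstance, AdjoinRoot.of Q,
    AdjoinRoot.not_isSumSq_neg_one_of_odd_natDegree hK Q hQ hodd, AdjoinRoot.root Q,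
    eval₂_eq_zero_of_dvd_of_eval₂_eq_zero _ _ hdvd (AdjoinRoot.eval₂_root Q)⟩

/-- Let `A` be a commutative von Neumann regular ring that is real
closed *. Then for every prime ideal `p` of `A`, the residue ring `A ⧸ p` is a real
closed field. -/
theorem stmt_10 {A : Type u} [CommRing A] (hvnr : ∀ a : A, ∃ b : A, a = a * b * a)
    (hrcs : IsRealClosedStar A) (p : Ideal A) (hp : p.IsPrime) :
    IsRealClosedField (A ⧸ p) := by
  have hdim := krullDimLE_zero_of_vonNeumannRegular hvnr
  have hreal (q : Ideal A) [q.IsPrime] : ¬ IsSumSq (-1 : A ⧸ q) :=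
    (hrcs.1.quotient hvnr q).not_isSumSq_neg_one
  have hker {q : Ideal A} [q.IsPrime] {L : Type u} [Field L] (φ : (A ⧸ q) →+* L)
      (hφ : Function.Injective φ) : RingHom.ker (φ.comp (Ideal.Quotient.mk q)) ≤ q := by
    intro a ha
    rw [← Ideal.Quotient.eq_zero_iff_mem]
    exact hφ (by simpa using ha)
  refine ⟨(Ideal.Quotient.maximal_ideal_iff_isField_quotient p).mp hp.isMaximal', ?_, ?_, ?_⟩
  · rintro ⟨n, f, hf⟩
    exact hreal p (hf ▸ IsSumSq.sum_sq _ _)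
  · intro x
    obtain ⟨a, rfl⟩ := Ideal.Quotient.mk_surjective x
    obtain ⟨y, hy⟩ := hrcs.exists_root hvnr (X ^ 4 - C (a ^ 2))
      (monic_X_pow_sub_C _ (by norm_num)) fun q ↦ by
        let _ := Ideal.Quotient.field q.asIdeal
        obtain ⟨L, _, φ, hL, z, hz⟩ :=
          exists_extension_pow_four_eq_sq (hreal q.asIdeal) (Ideal.Quotient.mk q.asIdeal a)
        exact ⟨L, _, φ.comp (Ideal.Quotient.mk q.asIdeal), hker φ φ.injective, hL, z,
          by rw [eval₂_sub, eval₂_X_pow, eval₂_C, hz]; simp⟩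
    have hy' : (y ^ 2 - a) * (y ^ 2 + a) = 0 := by
      simp at hy
      linear_combination hy
    have := congrArg (Ideal.Quotient.mk p) hy'
    rw [map_mul, map_zero, mul_eq_zero] at this
    refine this.imp (fun h ↦ ⟨Ideal.Quotient.mk p y, ?_⟩) fun h ↦ ⟨Ideal.Quotient.mk p y, ?_⟩
    · simpa [sub_eq_zero] using h
    · simpa [eq_neg_iff_add_eq_zero] using h
  · intro P hP
    let _ := Ideal.Quotient.field p
    have hP0 : P ≠ 0 := by
      rintro rfl
      simp at hP
    obtain ⟨Q, hQP, hQdeg, hQ⟩ := lifts_and_natDegree_eq_and_monic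
      (f := Ideal.Quotient.mk p) (p := P * C P.leadingCoeff⁻¹)
      (by
        rw [lifts_iff_coeff_lifts]
        exact fun n ↦ Ideal.Quotient.mk_surjective _)
      (monic_mul_leadingCoeff_inv hP0)
    rw [natDegree_mul_leadingCoeff_inv _ hP0] at hQdeg
    obtain ⟨y, hy⟩ := hrcs.exists_root hvnr Q hQ fun q ↦ by
      let _ := Ideal.Quotient.field q.asIdeal
      obtain ⟨L, _, φ, hL, z, hz⟩ := exists_extension_root_of_odd_natDegree (hreal q.asIdeal)
        (Q.map (Ideal.Quotient.mk q.asIdeal)) (by rw [hQ.natDegree_map, hQdeg]; exact hP)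
      exact ⟨L, _, φ.comp (Ideal.Quotient.mk q.asIdeal), hker φ φ.injective, hL, z,
        by rwa [eval₂_map] at hz⟩
    refine ⟨Ideal.Quotient.mk p y, ?_⟩
    have h : (P * C P.leadingCoeff⁻¹).eval (Ideal.Quotient.mk p y) = 0 := by
      rw [← hQP, eval_map_apply, hy, map_zero]
    rw [eval_mul, eval_C, mul_eq_zero] at h
    exact h.resolve_right (inv_ne_zero (leadingCoeff_ne_zero.mpr hP0))
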